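/- Let M_BNC be the unitary magma on {1, a, b} with unit 1 and operation ⋆ determined by a ⋆ a = a, b ⋆ b = b, and a ⋆ b = b ⋆ a = 1. Then the set consisting of the unit clique together with all noncrossing M_BNC-cliques whose base and edges are all labeled by a or by b (i.e., no edge and not the base is labeled 1) is closed under all partial compositions ∘_i of noncrossing M_BNC-cliques. -/

import Mathlib

/-! Bundled `M`-cliques for a unitary magma `M` (modeled as `MulOneClass`), with
1-indexed vertices `1, …, arity+1`, and their partial composition. -/

/-- A (bundled) `M`-clique: an arity `n ≥ 1` together with a labeling of the arcs
`(x,y)`, `1 ≤ x < y ≤ n+1`, by elements of `M`; the labeling is normalized to take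
the value `1` outside of this domain, so that equality of cliques is equality of
arities and labelings. -/
structure Cl (M : Type) [One M] where
  arity : ℕ
  lab : ℕ → ℕ → M
  norm : ∀ x y : ℕ, ¬(1 ≤ x ∧ x < y ∧ y ≤ arity + 1) → lab x y = 1

namespace Cl

/-- The unit clique: the unique noncrossing `M`-clique of arity 1. -/
def unitCl (M : Type) [One M] : Cl M :=
  ⟨1, fun _ _ => 1, fun _ _ _ => rfl⟩

variable {M : Type} [One M]

/-- `(x,y)` is a diagonal of `c`: an arc which is neither an edge `(i,i+1)` nor
the base `(1, arity+1)`. -/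
def IsDiag (c : Cl M) (x y : ℕ) : Prop :=
  1 ≤ x ∧ x < y ∧ y ≤ c.arity + 1 ∧ y ≠ x + 1 ∧ ¬(x = 1 ∧ y = c.arity + 1)

/-- A clique is noncrossing when no two of its solid diagonals cross. -/
def Noncrossing (c : Cl M) : Prop :=
  ∀ x y x' y' : ℕ, c.IsDiag x y → c.IsDiag x' y' →
    c.lab x y ≠ 1 → c.lab x' y' ≠ 1 →
    ¬((x < x' ∧ x' < y ∧ y < y') ∨ (x' < x ∧ x < y' ∧ y' < y))

/-- A bubble is a clique all of whose diagonals are labeled by the unit. -/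
def IsBubble (c : Cl M) : Prop := ∀ x y : ℕ, c.IsDiag x y → c.lab x y = 1

/-- Partial composition `p ∘ᵢ q` of cliques: glue the base of `q` onto the `i`-th
edge of `p`; the glued arc `(i, i + arity q)` is labeled `pᵢ ⋆ q₀`, the other arcs
of `p` and `q` keep their labels on their images, and all remaining arcs are
labeled by the unit. -/
def comp {M : Type} [MulOneClass M] (p : Cl M) (i : ℕ) (q : Cl M) : Cl M where
  arity := p.arity + q.arity - 1
  lab := fun x y =>
    if 1 ≤ x ∧ x < y ∧ y ≤ (p.arity + q.arity - 1) + 1 then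
      if x = i ∧ y = i + q.arity then
        p.lab i (i + 1) * q.lab 1 (q.arity + 1)
      else if i ≤ x ∧ y ≤ i + q.arity then
        q.lab (x - i + 1) (y - i + 1)
      else if (x ≤ i ∨ i + q.arity ≤ x) ∧ (y ≤ i ∨ i + q.arity ≤ y) then
        p.lab (if x ≤ i then x else x + 1 - q.arity)
          (if y ≤ i then y else y + 1 - q.arity)
      else 1
    else 1
  norm := fun _ _ h => if_neg h

end Cl

/-- The unitary magma `M_BNC = {1, a, b}`. -/
inductive MBNC : Type
  | one : MBNC
  | a : MBNC
  | b : MBNC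
deriving DecidableEq

namespace MBNC

instance : One MBNC := ⟨one⟩

/-- The product of `M_BNC`: `1` is the unit, `a ⋆ a = a`, `b ⋆ b = b`,
`a ⋆ b = b ⋆ a = 1`. -/
def mul : MBNC → MBNC → MBNC
  | one, x => x
  | x, one => x
  | a, a => a
  | b, b => b
  | a, b => one
  | b, a => one

instance : Mul MBNC := ⟨mul⟩

instance : MulOneClass MBNC where
  one_mul x := by cases x <;> rfl
  mul_one x := by cases x <;> rfl

end MBNC

/-- The set consisting of the unit clique together with all noncrossing
`M_BNC`-cliques whose base and edges are all labeled by `a` or by `b`. -/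
def SBNC : Set (Cl MBNC) :=
  {Cl.unitCl MBNC} ∪
    {c : Cl MBNC | 2 ≤ c.arity ∧ c.Noncrossing ∧
      (c.lab 1 (c.arity + 1) = MBNC.a ∨ c.lab 1 (c.arity + 1) = MBNC.b) ∧
      (∀ j : ℕ, 1 ≤ j → j ≤ c.arity →
        (c.lab j (j + 1) = MBNC.a ∨ c.lab j (j + 1) = MBNC.b))}

namespace Cl

theorem ext_of_eq {M : Type} [One M] {c d : Cl M} (h : c.arity = d.arity)
    (hl : ∀ x y, 1 ≤ x → x < y → y ≤ c.arity + 1 → c.lab x y = d.lab x y) : c = d := by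
  have hlab : c.lab = d.lab := by
    funext x y
    by_cases hxy : 1 ≤ x ∧ x < y ∧ y ≤ c.arity + 1
    · exact hl x y hxy.1 hxy.2.1 hxy.2.2
    · rw [c.norm x y hxy, d.norm x y (h ▸ hxy)]
  cases c; cases d; simp_all

theorem comp_unitCl {M : Type} [MulOneClass M] (p : Cl M) (i : ℕ) : p.comp i (unitCl M) = p := by
  refine ext_of_eq (by simp [comp, unitCl]) fun x y hx hxy hy => ?_
  simp only [comp, unitCl, Nat.add_sub_cancel, mul_one] at hy ⊢
  grind

theorem unitCl_comp {M : Type} [MulOneClass M] (q : Cl M) :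
    (unitCl M).comp 1 q = q := by
  refine ext_of_eq (by simp [comp, unitCl]) fun x y hx hxy hy => ?_
  simp only [comp, unitCl, one_mul] at hy ⊢
  grind

/-- A solid diagonal of `p ∘ᵢ q` is the glued arc, the image of a solid diagonal of `q`, or
the image of a solid diagonal of `p`. -/
theorem solid_diag_comp {M : Type} [MulOneClass M] {p q : Cl M} {i x y : ℕ}
    (hp : 2 ≤ p.arity) (hq : 2 ≤ q.arity) (hi : 1 ≤ i) (hip : i ≤ p.arity)
    (hd : (p.comp i q).IsDiag x y) (hs : (p.comp i q).lab x y ≠ 1) :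
    (x = i ∧ y = i + q.arity) ∨
    (∃ u v, q.IsDiag u v ∧ q.lab u v ≠ 1 ∧ x + 1 = u + i ∧ y + 1 = v + i) ∨
    (∃ u v, p.IsDiag u v ∧ p.lab u v ≠ 1 ∧
      (x = u ∧ u ≤ i ∨ x + 1 = u + q.arity ∧ i < u) ∧
      (y = v ∧ v ≤ i ∨ y + 1 = v + q.arity ∧ i < v)) := by
  obtain ⟨h1, h2, h3, h4, h5⟩ := hd
  simp only [comp] at h3 h5 hs
  rw [if_pos ⟨h1, h2, h3⟩] at hs
  split_ifs at hs with hg hqq hpp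
  · exact .inl hg
  · refine .inr (.inl ⟨_, _, ⟨?_, ?_, ?_, ?_, ?_⟩, hs, ?_, ?_⟩) <;> omega
  all_goals first
    | exact absurd rfl hs
    | refine .inr (.inr ⟨_, _, ⟨?_, ?_, ?_, ?_, ?_⟩, hs, ?_, ?_⟩) <;> omega

theorem Noncrossing.comp {M : Type} [MulOneClass M] {p q : Cl M} {i : ℕ}
    (hp : 2 ≤ p.arity) (hq : 2 ≤ q.arity) (hi : 1 ≤ i) (hip : i ≤ p.arity)
    (hpn : p.Noncrossing) (hqn : q.Noncrossing) : (p.comp i q).Noncrossing := by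
  intro x y x' y' hd hd' hs hs'
  rcases solid_diag_comp hp hq hi hip hd hs with
      h | ⟨u, v, hu, hl, hx, hy⟩ | ⟨u, v, hu, hl, hx, hy⟩ <;>
    rcases solid_diag_comp hp hq hi hip hd' hs' with
      h' | ⟨u', v', hu', hl', hx', hy'⟩ | ⟨u', v', hu', hl', hx', hy'⟩
  case inr.inl.inr.inl => have := hqn u v u' v' hu hu' hl hl'; omega
  case inr.inr.inr.inr => have := hpn u v u' v' hu hu' hl hl'; omega
  all_goals
    try obtain ⟨_, _, _, _⟩ := hu
    try obtain ⟨_, _, _, _⟩ := hu'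
    omega

theorem base_comp {M : Type} [MulOneClass M] {p q : Cl M} {i : ℕ}
    (hp : 2 ≤ p.arity) (hq : 2 ≤ q.arity) (hi : 1 ≤ i) (hip : i ≤ p.arity) :
    (p.comp i q).lab 1 ((p.comp i q).arity + 1) = p.lab 1 (p.arity + 1) := by
  simp only [comp]
  rw [if_pos (by omega), if_neg (by omega), if_neg (by omega), if_pos (by omega), if_pos hi,
    if_neg (by omega)]
  congr 1; omega

/-- Every edge of `p ∘ᵢ q` is the image of an edge of `p` or of `q`. -/
theorem exists_edge_comp {M : Type} [MulOneClass M] {p q : Cl M} {i j : ℕ}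
    (hq : 2 ≤ q.arity) (hip : i ≤ p.arity) (hj : 1 ≤ j) (hjc : j ≤ (p.comp i q).arity) :
    (∃ k, 1 ≤ k ∧ k ≤ p.arity ∧ (p.comp i q).lab j (j + 1) = p.lab k (k + 1)) ∨
    (∃ k, 1 ≤ k ∧ k ≤ q.arity ∧ (p.comp i q).lab j (j + 1) = q.lab k (k + 1)) := by
  simp only [comp] at hjc ⊢
  rw [if_pos (by omega), if_neg (by omega)]
  rcases lt_or_ge j i with h | h
  · refine .inl ⟨j, hj, by omega, ?_⟩
    rw [if_neg (by omega), if_pos (by omega), if_pos (by omega), if_pos (by omega)]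
  rcases lt_or_ge j (i + q.arity) with h' | h'
  · refine .inr ⟨j - i + 1, by omega, by omega, ?_⟩
    rw [if_pos (by omega)]
    congr 1; omega
  · refine .inl ⟨j + 1 - q.arity, by omega, by omega, ?_⟩
    rw [if_neg (by omega), if_pos (by omega), if_neg (by omega), if_neg (by omega)]
    congr 1; omega

end Cl

/-- `SBNC` is closed under all the partial compositions of noncrossing
`M_BNC`-cliques. -/
theorem statement19 :
    ∀ p ∈ SBNC, ∀ q ∈ SBNC, ∀ i : ℕ, 1 ≤ i → i ≤ p.arity → p.comp i q ∈ SBNC := by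
  intro p hp q hq i hi hip
  rcases hp with rfl | hp
  · obtain rfl : i = 1 := le_antisymm hip hi
    rwa [Cl.unitCl_comp]
  rcases hq with rfl | hq
  · rw [Cl.comp_unitCl]
    exact .inr hp
  obtain ⟨hp2, hpn, hpb, hpe⟩ := hp
  obtain ⟨hq2, hqn, -, hqe⟩ := hq
  refine .inr ⟨?_, hpn.comp hp2 hq2 hi hip hqn, ?_, fun j hj hjc => ?_⟩
  · change 2 ≤ p.arity + q.arity - 1
    omega
  · rwa [Cl.base_comp hp2 hq2 hi hip]
  · rcases Cl.exists_edge_comp hq2 hip hj hjc with ⟨k, hk, hk', h⟩ | ⟨k, hk, hk', h⟩ <;> rw [h]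
    · exact hpe k hk hk'
    · exact hqe k hk hk'
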